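/- Let G be a connected graph on n vertices with diameter 2. Then the ε-spectral radius satisfies ρ(ε(G)) ≤ (n-2) + √(n²-3n+3), with equality if and only if G is isomorphic to the star K_{1,n-1}. In other words, among all connected graphs on n vertices with diameter 2, the star is the unique graph with maximum ε-spectral radius. -/

import Mathlib

open Finset SimpleGraph

variable {V : Type*}

/-- The eccentricity of a vertex: the largest distance to another vertex. -/
noncomputable def ecc [Fintype V] (G : SimpleGraph V) (u : V) : ℕ :=
  Finset.univ.sup fun v => G.dist u v

/-- The diameter of a graph: the largest eccentricity. -/
noncomputable def gdiam [Fintype V] (G : SimpleGraph V) : ℕ :=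
  Finset.univ.sup fun u => ecc G u

/-- The eccentricity matrix: keep the distance `d(u,v)` if it equals
`min (e u) (e v)`, and put `0` otherwise. -/
noncomputable def eccMatrix [Fintype V] (G : SimpleGraph V) : Matrix V V ℝ :=
  Matrix.of fun u v =>
    if G.dist u v = min (ecc G u) (ecc G v) then (G.dist u v : ℝ) else 0

/-- The distance matrix of a graph. -/
noncomputable def distMatrix [Fintype V] (G : SimpleGraph V) : Matrix V V ℝ :=
  Matrix.of fun u v => (G.dist u v : ℝ)

/-- If a nonnegative symmetric matrix `A` satisfies `A w ≤ r w` for a positive vector `w`,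
then `r` bounds every eigenvalue `μ` of `A`; if `μ = r`, then `|v|` is again an eigenvector for
`r`, supported on the coordinates where `A w = r w`. -/
theorem Matrix.IsSymm.eigenvalue_le_of_mulVec_le [Fintype V] {A : Matrix V V ℝ}
    (hA : A.IsSymm) (hA0 : ∀ i j, 0 ≤ A i j) {w : V → ℝ} (hw : ∀ i, 0 < w i) {r : ℝ}
    (hr : ∀ i, ∑ j, A i j * w j ≤ r * w i) {v : V → ℝ} (hv : v ≠ 0) {μ : ℝ}
    (hμ : ∀ i, ∑ j, A i j * v j = μ * v i) :
    μ ≤ r ∧ (μ = r → (∀ i, ∑ j, A i j * |v j| = r * |v i|) ∧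
      ∀ i, (r * w i - ∑ j, A i j * w j) * |v i| = 0) := by
  have h1 : ∀ i, μ * |v i| ≤ ∑ j, A i j * |v j| := fun i => by
    calc μ * |v i| ≤ |μ| * |v i| := by gcongr; exact le_abs_self μ
      _ = |∑ j, A i j * v j| := by rw [hμ, abs_mul]
      _ ≤ ∑ j, |A i j * v j| := Finset.abs_sum_le_sum_abs _ _
      _ = ∑ j, A i j * |v j| := by simp [abs_mul, abs_of_nonneg (hA0 _ _)]
  have hpos : 0 < ∑ i, w i * |v i| := by
    obtain ⟨i, hi⟩ := Function.ne_iff.mp hv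
    exact Finset.sum_pos' (fun i _ => mul_nonneg (hw i).le (abs_nonneg _))
      ⟨i, Finset.mem_univ _, mul_pos (hw i) (abs_pos.mpr hi)⟩
  have hswap : ∑ i, w i * ∑ j, A i j * |v j| = ∑ i, (∑ j, A i j * w j) * |v i| := by
    simp only [Finset.mul_sum, Finset.sum_mul]
    rw [Finset.sum_comm]
    refine Finset.sum_congr rfl fun i _ => Finset.sum_congr rfl fun j _ => ?_
    rw [hA.apply]; ring
  have hkey : (r - μ) * ∑ i, w i * |v i| =
      ∑ i, w i * (∑ j, A i j * |v j| - μ * |v i|) +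
        ∑ i, (r * w i - ∑ j, A i j * w j) * |v i| := by
    simp only [mul_sub, sub_mul, Finset.sum_sub_distrib, hswap]
    simp only [Finset.mul_sum, mul_assoc, mul_left_comm]
    ring
  have hX : ∀ i ∈ Finset.univ, 0 ≤ w i * (∑ j, A i j * |v j| - μ * |v i|) := fun i _ =>
    mul_nonneg (hw i).le (sub_nonneg.mpr (h1 i))
  have hY : ∀ i ∈ Finset.univ, 0 ≤ (r * w i - ∑ j, A i j * w j) * |v i| := fun i _ =>
    mul_nonneg (sub_nonneg.mpr (hr i)) (abs_nonneg _)
  have hX' := Finset.sum_nonneg hX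
  have hY' := Finset.sum_nonneg hY
  refine ⟨?_, ?_⟩
  · by_contra! h
    nlinarith
  · rintro rfl
    rw [sub_self, zero_mul] at hkey
    refine ⟨fun i => ?_, fun i => ?_⟩
    · have := (Finset.sum_eq_zero_iff_of_nonneg hX).mp (by linarith) i (Finset.mem_univ i)
      have := (mul_eq_zero.mp this).resolve_left (hw i).ne'
      linarith
    · exact (Finset.sum_eq_zero_iff_of_nonneg hY).mp (by linarith) i (Finset.mem_univ i)

/-- A graph on `n` vertices is a star iff some vertex `c` is such that the edges are exactly the
pairs of distinct vertices containing `c`. -/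
theorem SimpleGraph.nonempty_iso_star_iff [Fintype V] [DecidableEq V] {n : ℕ}
    (hn : Fintype.card V = n) (G : SimpleGraph V) :
    Nonempty (G ≃g completeBipartiteGraph (Fin 1) (Fin (n - 1))) ↔
      ∃ c, ∀ a b, G.Adj a b ↔ a ≠ b ∧ (a = c ∨ b = c) := by
  constructor
  · rintro ⟨φ⟩
    refine ⟨φ.symm (Sum.inl 0), fun a b => ?_⟩
    rw [← φ.map_adj_iff, ← φ.injective.ne_iff, RelIso.eq_symm_apply, RelIso.eq_symm_apply]
    rcases φ a with x | x <;> rcases φ b with y | y <;>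
      simp [completeBipartiteGraph, Fin.fin_one_eq_zero]
  · rintro ⟨c, hc⟩
    have hcard : Fintype.card {x // ¬ x = c} = n - 1 := by
      rw [Fintype.card_subtype_compl, hn, Fintype.card_subtype_eq]
    let e : V ≃ Fin 1 ⊕ Fin (n - 1) := (Equiv.sumCompl (fun x => x = c)).symm.trans
      (Equiv.sumCongr (Equiv.ofUnique _ _) (Fintype.equivFinOfCardEq hcard))
    have hl : ∀ a, (e a).isLeft ↔ a = c := fun a => by
      by_cases h : a = c <;> simp [e, h]
    have hr : ∀ a, (e a).isRight ↔ a ≠ c := fun a => by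
      by_cases h : a = c <;> simp [e, h]
    refine ⟨⟨e, fun {a b} => ?_⟩⟩
    simp only [completeBipartiteGraph, hl, hr, hc]
    grind

section EccMatrix

variable [Fintype V] {G : SimpleGraph V}

theorem dist_le_ecc (G : SimpleGraph V) (u v : V) : G.dist u v ≤ ecc G u :=
  Finset.le_sup (f := fun v => G.dist u v) (Finset.mem_univ v)

theorem ecc_le_gdiam (G : SimpleGraph V) (u : V) : ecc G u ≤ gdiam G :=
  Finset.le_sup (f := fun u => ecc G u) (Finset.mem_univ u)

theorem eccMatrix_nonneg (u v : V) : 0 ≤ eccMatrix G u v := by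
  simp only [eccMatrix, Matrix.of_apply]
  split_ifs <;> positivity

theorem eccMatrix_le_dist (u v : V) : eccMatrix G u v ≤ G.dist u v := by
  simp only [eccMatrix, Matrix.of_apply]
  split_ifs <;> simp

theorem eccMatrix_self (u : V) : eccMatrix G u u = 0 := by
  simp [eccMatrix]

/-- The entry of an adjacent pair is zero if both of its vertices have eccentricity at least
two. -/
theorem eccMatrix_eq_zero_of_adj {u v : V} (h : G.Adj u v) (hu : 2 ≤ ecc G u)
    (hv : 2 ≤ ecc G v) : eccMatrix G u v = 0 := by
  have h1 := dist_eq_one_iff_adj.mpr h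
  simp only [eccMatrix, Matrix.of_apply, h1]
  rw [if_neg (by omega)]

theorem ecc_eq_one_of_forall_adj [Nontrivial V] {c : V} (hc : ∀ v, v ≠ c → G.Adj c v) :
    ecc G c = 1 := by
  apply le_antisymm
  · refine Finset.sup_le fun v _ => ?_
    by_cases hv : v = c
    · simp [hv]
    · exact (dist_eq_one_iff_adj.mpr (hc v hv)).le
  · obtain ⟨v, hv⟩ := exists_ne c
    rw [← dist_eq_one_iff_adj.mpr (hc v hv)]
    exact dist_le_ecc G c v

theorem one_le_ecc [Nontrivial V] (hG : G.Connected) (u : V) : 1 ≤ ecc G u := by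
  obtain ⟨v, hv⟩ := exists_ne u
  exact (hG.pos_dist_of_ne hv.symm).trans_le (dist_le_ecc G u v)

theorem two_le_ecc_of_not_adj (hG : G.Connected) {u v : V} (huv : v ≠ u)
    (h : ¬ G.Adj u v) : 2 ≤ ecc G u := by
  have h0 := hG.pos_dist_of_ne huv.symm
  have h1 : G.dist u v ≠ 1 := fun h1 => h (dist_eq_one_iff_adj.mp h1)
  have := dist_le_ecc G u v
  omega

theorem eccMatrix_eq_one_of_forall_adj [Nontrivial V] (hG : G.Connected) {c : V}
    (hc : ∀ v, v ≠ c → G.Adj c v) {v : V} (hv : v ≠ c) : eccMatrix G c v = 1 := by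
  have h1 := dist_eq_one_iff_adj.mpr (hc v hv)
  have h2 := ecc_eq_one_of_forall_adj hc
  have h3 := one_le_ecc hG v
  simp only [eccMatrix, Matrix.of_apply, h1, h2]
  rw [if_pos (by omega)]
  simp

theorem eccMatrix_eq_two (hG : G.Connected) (hd : gdiam G = 2) {u v : V} (huv : u ≠ v)
    (h : ¬ G.Adj u v) : eccMatrix G u v = 2 := by
  have h0 := hG.pos_dist_of_ne huv
  have h1 : G.dist u v ≠ 1 := fun h1 => h (dist_eq_one_iff_adj.mp h1)
  have h2 := dist_le_ecc G u v
  have h3 := dist_le_ecc G v u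
  rw [dist_comm] at h3
  have h4 := ecc_le_gdiam G u
  have h5 := ecc_le_gdiam G v
  have h6 : G.dist u v = 2 := by omega
  simp only [eccMatrix, Matrix.of_apply, h6]
  rw [if_pos (by omega)]
  simp

theorem nontrivial_of_gdiam_ne_zero (hd : gdiam G ≠ 0) : Nontrivial V := by
  by_contra h
  rw [not_nontrivial_iff_subsingleton] at h
  refine hd (Nat.le_zero.mp (Finset.sup_le fun u _ => Finset.sup_le fun v _ => ?_))
  simp [Subsingleton.elim u v]

/-- Without a universal vertex, each row of the eccentricity matrix of a connected graph of
diameter two sums to at most `2 (n - 2)`. -/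
theorem sum_eccMatrix_le [DecidableEq V] (hG : G.Connected) (hd : gdiam G = 2)
    (hc : ∀ c, ∃ v, v ≠ c ∧ ¬ G.Adj c v) (u : V) :
    ∑ v, eccMatrix G u v ≤ 2 * ((Fintype.card V : ℝ) - 2) := by
  have := nontrivial_of_gdiam_ne_zero (G := G) (by omega)
  have hecc : ∀ c, 2 ≤ ecc G c := fun c => by
    obtain ⟨v, hv, h⟩ := hc c
    exact two_le_ecc_of_not_adj hG hv h
  obtain ⟨x, hx⟩ := hG.preconnected.exists_adj_of_nontrivial u
  have hle : ∀ v, eccMatrix G u v ≤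
      2 - (if v = u then 2 else 0) - (if v = x then 2 else 0) := fun v => by
    by_cases hvu : v = u
    · subst hvu
      simp [eccMatrix_self, hx.ne]
    · by_cases hvx : v = x
      · subst hvx
        simp [eccMatrix_eq_zero_of_adj hx (hecc _) (hecc _), hvu]
      · have h1 := eccMatrix_le_dist (G := G) u v
        have h2 : (G.dist u v : ℝ) ≤ 2 := by
          exact_mod_cast hd ▸ (dist_le_ecc G u v).trans (ecc_le_gdiam G u)
        simpa [hvu, hvx] using h1.trans h2
  refine (Finset.sum_le_sum fun v _ => hle v).trans (le_of_eq ?_)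
  simp [Finset.sum_sub_distrib]
  ring

/-- The eccentricity matrix of the star with centre `c`. -/
def starEccMatrix [DecidableEq V] (c : V) : Matrix V V ℝ :=
  Matrix.of fun u v => if u = v then 0 else if u = c ∨ v = c then 1 else 2

theorem sum_starEccMatrix_mul [DecidableEq V] (c : V) {r : ℝ}
    (hr : r ^ 2 = 2 * ((Fintype.card V : ℝ) - 2) * r + ((Fintype.card V : ℝ) - 1)) (u : V) :
    ∑ v, starEccMatrix c u v * (if v = c then (Fintype.card V : ℝ) - 1 else r) =
      r * (if u = c then (Fintype.card V : ℝ) - 1 else r) := by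
  by_cases hu : u = c
  · subst hu
    have : ∀ v, starEccMatrix u u v * (if v = u then (Fintype.card V : ℝ) - 1 else r) =
        r - if v = u then r else 0 := fun v => by
      by_cases h : v = u
      · simp [starEccMatrix, h]
      · simp [starEccMatrix, h, Ne.symm h]
    simp [this, Finset.sum_sub_distrib]
    ring
  · have : ∀ v, starEccMatrix c u v * (if v = c then (Fintype.card V : ℝ) - 1 else r) =
        2 * r - (if v = u then 2 * r else 0) -
          (if v = c then 2 * r - ((Fintype.card V : ℝ) - 1) else 0) := fun v => by
      by_cases h : v = u
      · subst h
        simp [starEccMatrix, hu]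
      · by_cases h' : v = c
        · simp [starEccMatrix, h', hu, Ne.symm hu]
        · simp [starEccMatrix, h, h', hu, Ne.symm h]
    simp [this, Finset.sum_sub_distrib, hu]
    linarith

theorem eccMatrix_le_starEccMatrix [DecidableEq V]
    (hd : gdiam G = 2) {c : V} (hc : ∀ v, v ≠ c → G.Adj c v) (u v : V) :
    eccMatrix G u v ≤ starEccMatrix c u v := by
  have h1 := eccMatrix_le_dist (G := G) u v
  simp only [starEccMatrix, Matrix.of_apply]
  split_ifs with huv huc
  · simp [huv, eccMatrix_self]
  · have hadj : G.Adj u v := by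
      rcases huc with rfl | rfl
      · exact hc v (Ne.symm huv)
      · exact (hc u huv).symm
    simpa [dist_eq_one_iff_adj.mpr hadj] using h1
  · exact h1.trans (by exact_mod_cast hd ▸ (dist_le_ecc G u v).trans (ecc_le_gdiam G u))

theorem eccMatrix_eq_starEccMatrix [DecidableEq V] [Nontrivial V] (hG : G.Connected)
    (hd : gdiam G = 2) {c : V} (hc : ∀ a b, G.Adj a b ↔ a ≠ b ∧ (a = c ∨ b = c))
    (hE : (eccMatrix G).IsSymm) :
    eccMatrix G = starEccMatrix c := by
  have huniv : ∀ v, v ≠ c → G.Adj c v := fun v hv => (hc c v).mpr ⟨hv.symm, Or.inl rfl⟩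
  ext u v
  simp only [starEccMatrix, Matrix.of_apply]
  split_ifs with huv huc
  · simp [huv, eccMatrix_self]
  · rcases huc with rfl | rfl
    · exact eccMatrix_eq_one_of_forall_adj hG huniv (Ne.symm huv)
    · rw [← hE.apply]
      exact eccMatrix_eq_one_of_forall_adj hG huniv huv
  · exact eccMatrix_eq_two hG hd huv fun h => huc ((hc u v).mp h).2

/-- In presence of a universal vertex `c`, an eigenvalue of the eccentricity matrix is at most the
spectral radius `r` of the star, and it equals `r` only if all edges contain `c`. -/
theorem eccMatrix_eigenvalue_le_of_forall_adj [DecidableEq V] [Nontrivial V]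
    (hG : G.Connected) (hd : gdiam G = 2) {c : V} (hc : ∀ v, v ≠ c → G.Adj c v)
    (hE : (eccMatrix G).IsSymm) {r : ℝ} (hr0 : 0 < r)
    (hr : r ^ 2 = 2 * ((Fintype.card V : ℝ) - 2) * r + ((Fintype.card V : ℝ) - 1))
    {v : V → ℝ} (hv : v ≠ 0) {μ : ℝ} (hμ : ∀ i, ∑ j, eccMatrix G i j * v j = μ * v i) :
    μ ≤ r ∧ (μ = r → ∀ a b, G.Adj a b ↔ a ≠ b ∧ (a = c ∨ b = c)) := by
  set w : V → ℝ := fun v => if v = c then (Fintype.card V : ℝ) - 1 else r with hw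
  have hw0 : ∀ i, 0 < w i := fun i => by
    have : (1 : ℝ) < Fintype.card V := by exact_mod_cast Fintype.one_lt_card
    simp only [hw]
    split_ifs <;> linarith
  have hMw : ∀ i, ∑ j, starEccMatrix c i j * w j = r * w i := sum_starEccMatrix_mul c hr
  have hle : ∀ i j, eccMatrix G i j * w j ≤ starEccMatrix c i j * w j := fun i j =>
    mul_le_mul_of_nonneg_right (eccMatrix_le_starEccMatrix hd hc i j) (hw0 j).le
  obtain ⟨h1, h2⟩ := hE.eigenvalue_le_of_mulVec_le eccMatrix_nonneg hw0
    (fun i => (Finset.sum_le_sum fun j _ => hle i j).trans (hMw i).le) hv hμ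
  refine ⟨h1, fun heq => ?_⟩
  obtain ⟨h3, h4⟩ := h2 heq
  have hzero : ∀ i, v i = 0 → ∀ j, eccMatrix G i j ≠ 0 → v j = 0 := fun i hi j hj => by
    have h5 := h3 i
    rw [hi, abs_zero, mul_zero, Finset.sum_eq_zero_iff_of_nonneg
      fun j _ => mul_nonneg (eccMatrix_nonneg i j) (abs_nonneg _)] at h5
    exact abs_eq_zero.mp ((mul_eq_zero.mp (h5 j (Finset.mem_univ j))).resolve_left hj)
  have hrow : ∀ x, x ≠ c → eccMatrix G c x ≠ 0 := fun x hx => by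
    simp [eccMatrix_eq_one_of_forall_adj hG hc hx]
  intro a b
  refine ⟨fun hab => ⟨hab.ne, ?_⟩, ?_⟩
  · by_contra! hne
    have hlt : ∑ j, eccMatrix G a j * w j < r * w a := by
      rw [← hMw a]
      refine Finset.sum_lt_sum (fun j _ => hle a j) ⟨b, Finset.mem_univ b, ?_⟩
      refine mul_lt_mul_of_pos_right ?_ (hw0 b)
      have h5 := eccMatrix_le_dist (G := G) a b
      rw [dist_eq_one_iff_adj.mpr hab] at h5
      have h6 : starEccMatrix c a b = 2 := by simp [starEccMatrix, hab.ne, hne]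
      rw [h6]
      push_cast at h5
      linarith
    have hva : v a = 0 :=
      abs_eq_zero.mp ((mul_eq_zero.mp (h4 a)).resolve_left (sub_pos.mpr hlt).ne')
    have hvc : v c = 0 := hzero a hva c (by rw [← hE.apply]; exact hrow a hne.1)
    refine hv (funext fun x => ?_)
    by_cases hx : x = c
    · rw [hx, hvc]; rfl
    · exact hzero c hvc x (hrow x hx)
  · rintro ⟨hne, rfl | rfl⟩
    · exact hc b hne.symm
    · exact (hc a hne).symm

end EccMatrix

/-- Among connected graphs on `n` vertices with diameter 2, the
ε-spectral radius is at most `(n-2) + √(n²-3n+3)`, with equality iff the graph is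
isomorphic to the star `K_{1,n-1}`. -/
theorem eccMatrix_spectralRadius_le_of_diam_two [Fintype V] [DecidableEq V] [Nonempty V]
    (n : ℕ) (hn : Fintype.card V = n) (G : SimpleGraph V) (hG : G.Connected)
    (hd : gdiam G = 2) (hE : (eccMatrix G).IsHermitian) :
    (⨆ i, hE.eigenvalues i) ≤ ((n : ℝ) - 2) + Real.sqrt ((n : ℝ) ^ 2 - 3 * n + 3) ∧
    ((⨆ i, hE.eigenvalues i) = ((n : ℝ) - 2) + Real.sqrt ((n : ℝ) ^ 2 - 3 * n + 3) ↔
      Nonempty (G ≃g completeBipartiteGraph (Fin 1) (Fin (n - 1)))) := by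
  have := nontrivial_of_gdiam_ne_zero (G := G) (by omega)
  have hsymm : (eccMatrix G).IsSymm := by
    rwa [Matrix.IsHermitian, Matrix.conjTranspose_eq_transpose_of_trivial] at hE
  have hn2 : (2 : ℝ) ≤ n := by exact_mod_cast hn ▸ Fintype.one_lt_card (α := V)
  rw [SimpleGraph.nonempty_iso_star_iff hn]
  set s := Real.sqrt ((n : ℝ) ^ 2 - 3 * n + 3) with hs
  have hs2 : s ^ 2 = (n : ℝ) ^ 2 - 3 * n + 3 := Real.sq_sqrt (by nlinarith)
  have hs0 : 0 ≤ s := Real.sqrt_nonneg _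
  have hsn : (n : ℝ) - 2 < s := by nlinarith
  set r := (n : ℝ) - 2 + s with hrdef
  have hr0 : 0 < r := by linarith
  have hr : r ^ 2 = 2 * ((Fintype.card V : ℝ) - 2) * r + ((Fintype.card V : ℝ) - 1) := by
    rw [hn, hrdef]
    linear_combination hs2
  have heig : ∀ i, hE.eigenvalues i ≤ r ∧
      (hE.eigenvalues i = r → ∃ c, ∀ a b, G.Adj a b ↔ a ≠ b ∧ (a = c ∨ b = c)) := fun i => by
    have hv : ⇑(hE.eigenvectorBasis i) ≠ (0 : V → ℝ) := fun h =>
      hE.eigenvectorBasis.orthonormal.ne_zero i (by ext x; exact congrFun h x)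
    have hμ : ∀ x, ∑ y, eccMatrix G x y * hE.eigenvectorBasis i y =
        hE.eigenvalues i * hE.eigenvectorBasis i x := fun x => by
      simpa [Matrix.mulVec, dotProduct] using congrFun (hE.mulVec_eigenvectorBasis i) x
    by_cases hc : ∃ c, ∀ v, v ≠ c → G.Adj c v
    · obtain ⟨c, hc⟩ := hc
      obtain ⟨h1, h2⟩ := eccMatrix_eigenvalue_le_of_forall_adj hG hd hc hsymm hr0 hr hv hμ
      exact ⟨h1, fun h => ⟨c, h2 h⟩⟩
    · push Not at hc
      have h1 := (hsymm.eigenvalue_le_of_mulVec_le eccMatrix_nonneg (w := fun _ => 1)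
        (fun _ => one_pos) (r := 2 * ((n : ℝ) - 2))
        (fun x => by simpa [hn] using sum_eccMatrix_le hG hd hc x) hv hμ).1
      have h2 : hE.eigenvalues i < r := by linarith
      exact ⟨h2.le, fun h => absurd h h2.ne⟩
  have hle : (⨆ i, hE.eigenvalues i) ≤ r := ciSup_le fun i => (heig i).1
  refine ⟨hle, fun h => ?_, fun ⟨c, hc⟩ => le_antisymm hle ?_⟩
  · obtain ⟨i, hi⟩ := exists_eq_ciSup_of_finite (f := hE.eigenvalues)
    exact (heig i).2 (hi.trans h)
  · have hmem : r ∈ spectrum ℝ (eccMatrix G) := by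
      rw [← Matrix.spectrum_toLin', ← Module.End.hasEigenvalue_iff_mem_spectrum]
      refine Module.End.hasEigenvalue_of_hasEigenvector
        (x := fun v => if v = c then (Fintype.card V : ℝ) - 1 else r)
        (Module.End.hasEigenvector_iff.mpr ⟨Module.End.mem_eigenspace_iff.mpr ?_, fun h => ?_⟩)
      · rw [eccMatrix_eq_starEccMatrix hG hd hc hsymm]
        exact funext fun u => sum_starEccMatrix_mul c hr u
      · obtain ⟨x, hx⟩ := exists_ne c
        have := congrFun h x
        simp [hx, hr0.ne'] at this
    rw [hE.spectrum_real_eq_range_eigenvalues] at hmem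
    obtain ⟨i, hi⟩ := hmem
    rw [← hi]
    exact le_ciSup (Set.finite_range _).bddAbove i
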